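/- Let (Ω, 𝓕) be a measurable space, B the set of bounded measurable functions Ω → ℝ with the supremum metric, and D ⊆ B a convex set that contains a supremum-metric ball around some constant function k. Let I : D → ℝ be monotone (X(ω) ≥ Y(ω) for all ω implies I(X) ≥ I(Y) for X, Y ∈ D). Then I is antimonotonically affine if and only if I is affine, i.e., I(αX + (1−α)Y) = αI(X) + (1−α)I(Y) for all α ∈ [0,1] and all X, Y ∈ D. -/

import Mathlib

/-- Two functions `X, Y : Ω → ℝ` are comonotonic if
`(X ω - X ω') * (Y ω - Y ω') ≥ 0` for all `ω, ω'`. -/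
def Comonotonic {Ω : Type*} (X Y : Ω → ℝ) : Prop :=
  ∀ ω ω' : Ω, (X ω - X ω') * (Y ω - Y ω') ≥ 0

/-- `X` and `Y` are antimonotonic if `X` and `-Y` are comonotonic. -/
def Antimonotonic {Ω : Type*} (X Y : Ω → ℝ) : Prop :=
  Comonotonic X (-Y)

/-- The set of bounded measurable real-valued functions on `Ω`. -/
def BddMeas (Ω : Type*) [MeasurableSpace Ω] : Set (Ω → ℝ) :=
  {X | Measurable X ∧ ∃ M : ℝ, ∀ ω, |X ω| ≤ M}

namespace BddMeas

variable {Ω : Type*} [MeasurableSpace Ω]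

lemma const_mem (c : ℝ) : (fun _ => c : Ω → ℝ) ∈ BddMeas Ω :=
  ⟨measurable_const, |c|, fun _ => le_rfl⟩

lemma add_mem {X Y : Ω → ℝ} (hX : X ∈ BddMeas Ω) (hY : Y ∈ BddMeas Ω) : X + Y ∈ BddMeas Ω := by
  obtain ⟨hX, M, hM⟩ := hX
  obtain ⟨hY, N, hN⟩ := hY
  exact ⟨hX.add hY, M + N, fun ω => (abs_add_le _ _).trans (add_le_add (hM ω) (hN ω))⟩

lemma smul_mem {X : Ω → ℝ} (c : ℝ) (hX : X ∈ BddMeas Ω) : c • X ∈ BddMeas Ω := by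
  obtain ⟨hX, M, hM⟩ := hX
  refine ⟨hX.const_smul c, |c| * M, fun ω => ?_⟩
  rw [Pi.smul_apply, smul_eq_mul, abs_mul]
  exact mul_le_mul_of_nonneg_left (hM ω) (abs_nonneg c)

lemma indicator_mem {X : Ω → ℝ} (hX : X ∈ BddMeas Ω) {A : Set Ω} (hA : MeasurableSet A) :
    A.indicator X ∈ BddMeas Ω := by
  obtain ⟨hX, M, hM⟩ := hX
  refine ⟨hX.indicator hA, M, fun ω => ?_⟩
  by_cases h : ω ∈ A
  · simpa [h] using hM ω
  · simpa [h] using (abs_nonneg _).trans (hM ω)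

lemma sub_const_mem {X : Ω → ℝ} (hX : X ∈ BddMeas Ω) (c : ℝ) :
    (fun ω => X ω - c) ∈ BddMeas Ω := by
  simpa [sub_eq_add_neg] using! add_mem hX (const_mem (-c))

/-- A function with finite range that factors through a measurable map is bounded measurable. -/
lemma comp_mem {ι : Type*} [MeasurableSpace ι] {φ : Ω → ι} (hφ : Measurable φ)
    (hfin : (Set.range φ).Finite) {g : ι → ℝ} (hg : Measurable g) :
    (fun ω => g (φ ω)) ∈ BddMeas Ω := by
  obtain ⟨M, hM⟩ := (hfin.image fun b => |g b|).bddAbove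
  exact ⟨hg.comp hφ, M, fun ω => hM ⟨φ ω, ⟨ω, rfl⟩, rfl⟩⟩

lemma exists_pos_mul_abs_le {X Y : Ω → ℝ} (hX : X ∈ BddMeas Ω) (hY : Y ∈ BddMeas Ω) {ε : ℝ}
    (hε : 0 < ε) :
    ∃ t, 0 < t ∧ t ≤ 1 ∧ (∀ ω, t * |X ω| ≤ ε) ∧ ∀ ω, t * |Y ω| ≤ ε := by
  obtain ⟨-, M, hM⟩ := hX
  obtain ⟨-, N, hN⟩ := hY
  have hK : 0 < |M| + |N| + 1 := by positivity
  have key : ∀ x : ℝ, |x| ≤ |M| + |N| + 1 → min 1 (ε / (|M| + |N| + 1)) * |x| ≤ ε := by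
    intro x hx
    calc min 1 (ε / (|M| + |N| + 1)) * |x|
        ≤ ε / (|M| + |N| + 1) * (|M| + |N| + 1) :=
          mul_le_mul (min_le_right _ _) hx (abs_nonneg _) (by positivity)
      _ = ε := div_mul_cancel₀ _ hK.ne'
  refine ⟨min 1 (ε / (|M| + |N| + 1)), by positivity, min_le_left _ _,
    fun ω => key _ ?_, fun ω => key _ ?_⟩
  · linarith [hM ω, le_abs_self M, abs_nonneg N]
  · linarith [hN ω, le_abs_self N, abs_nonneg M]

end BddMeas

lemma antimonotonic_const_right {Ω : Type*} (X : Ω → ℝ) (c : ℝ) :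
    Antimonotonic X (fun _ => c) := by
  intro ω ω'
  simp

lemma antimonotonic_of_nonneg_of_mul_eq_zero {Ω : Type*} {X Y : Ω → ℝ} (hX : ∀ ω, 0 ≤ X ω)
    (hY : ∀ ω, 0 ≤ Y ω) (h : ∀ ω, X ω * Y ω = 0) : Antimonotonic X Y := by
  intro ω ω'
  simp only [Pi.neg_apply]
  nlinarith [h ω, h ω', mul_nonneg (hX ω) (hY ω'), mul_nonneg (hX ω') (hY ω)]

lemma Antimonotonic.smul {Ω : Type*} {X Y : Ω → ℝ} (h : Antimonotonic X Y) {a b : ℝ}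
    (ha : 0 ≤ a) (hb : 0 ≤ b) (k : ℝ) :
    Antimonotonic (fun ω => k + a * X ω) (fun ω => k + b * Y ω) := by
  intro ω ω'
  have h' := mul_nonneg (mul_nonneg ha hb) (h ω ω')
  simp only [Pi.neg_apply] at h' ⊢
  linarith

section Additivity

variable {Ω : Type*} [MeasurableSpace Ω] {J : (Ω → ℝ) → ℝ}

/-- A functional additive on antimonotonic pairs acts on nonnegative functions of finite range
as integration against the finitely additive set function it induces. -/
lemma map_comp_eq_sum
    (hadd : ∀ X ∈ BddMeas Ω, ∀ Y ∈ BddMeas Ω, Antimonotonic X Y → J (X + Y) = J X + J Y)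
    (hsmul : ∀ c : ℝ, 0 ≤ c → ∀ X ∈ BddMeas Ω, J (c • X) = c * J X)
    {ι : Type*} [MeasurableSpace ι] [MeasurableSingletonClass ι] {φ : Ω → ι} (hφ : Measurable φ)
    (hfin : (Set.range φ).Finite) {g : ι → ℝ} (hg : Measurable g) (hg0 : ∀ ω, 0 ≤ g (φ ω)) :
    J (fun ω => g (φ ω)) =
      ∑ b ∈ hfin.toFinset, g b * J ((φ ⁻¹' {b}).indicator fun _ => 1) := by
  classical
  have key : ∀ S : Finset ι, (∀ b ∈ S, 0 ≤ g b) →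
      J ((φ ⁻¹' S).indicator fun ω => g (φ ω)) =
        ∑ b ∈ S, g b * J ((φ ⁻¹' {b}).indicator fun _ => 1) := by
    intro S
    induction S using Finset.induction_on with
    | empty =>
      intro _
      have h0 := hsmul 0 le_rfl _ (BddMeas.const_mem (Ω := Ω) 0)
      rw [zero_smul, zero_mul] at h0
      simpa using! h0
    | insert a S ha ih =>
      intro hS
      have hS' : ∀ b ∈ S, 0 ≤ g b := fun b hb => hS b (Finset.mem_insert_of_mem hb)
      have hga : 0 ≤ g a := hS a (Finset.mem_insert_self _ _)
      have hA : (φ ⁻¹' {a}).indicator (fun _ => (1 : ℝ)) ∈ BddMeas Ω :=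
        BddMeas.indicator_mem (BddMeas.const_mem 1) (hφ (measurableSet_singleton a))
      have hB : (φ ⁻¹' S).indicator (fun ω => g (φ ω)) ∈ BddMeas Ω :=
        BddMeas.indicator_mem (BddMeas.comp_mem hφ hfin hg) (hφ S.measurableSet)
      have hsplit : (φ ⁻¹' (insert a S : Finset ι)).indicator (fun ω => g (φ ω)) =
          g a • (φ ⁻¹' {a}).indicator (fun _ => (1 : ℝ)) +
            (φ ⁻¹' S).indicator fun ω => g (φ ω) := by
        funext ω
        by_cases h : φ ω = a
        · simp [Set.indicator, h, ha]
        · simp [Set.indicator, h]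
      rw [Finset.sum_insert ha, ← ih hS', ← hsmul _ hga _ hA, hsplit]
      refine hadd _ (BddMeas.smul_mem _ hA) _ hB
        (antimonotonic_of_nonneg_of_mul_eq_zero (fun ω => ?_) (fun ω => ?_) fun ω => ?_)
      · by_cases h : φ ω = a <;> simp [Set.indicator, h, hga]
      · by_cases h : φ ω ∈ S
        · simpa [Set.indicator, h] using hS' _ h
        · simp [Set.indicator, h]
      · by_cases h : φ ω = a <;> simp [Set.indicator, h, ha]
  rw [← key hfin.toFinset (by simpa using hg0)]
  congr 1
  funext ω
  simp

lemma map_add_of_nonneg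
    (hmono : ∀ X ∈ BddMeas Ω, ∀ Y ∈ BddMeas Ω, (∀ ω, X ω ≤ Y ω) → J X ≤ J Y)
    (hadd : ∀ X ∈ BddMeas Ω, ∀ Y ∈ BddMeas Ω, Antimonotonic X Y → J (X + Y) = J X + J Y)
    (hsmul : ∀ c : ℝ, 0 ≤ c → ∀ X ∈ BddMeas Ω, J (c • X) = c * J X)
    {X Y : Ω → ℝ} (hX : X ∈ BddMeas Ω) (hY : Y ∈ BddMeas Ω)
    (hX0 : ∀ ω, 0 ≤ X ω) (hY0 : ∀ ω, 0 ≤ Y ω) : J (X + Y) = J X + J Y := by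
  set m := J fun _ => 1 with hm
  have hbound : ∀ n : ℕ, (n : ℝ) * |J (X + Y) - (J X + J Y)| ≤ 2 * m := by
    intro n
    have hn : (0 : ℝ) ≤ n := n.cast_nonneg
    let φ : Ω → ℤ × ℤ := fun ω => (⌊n * X ω⌋, ⌊n * Y ω⌋)
    have hφ : Measurable φ :=
      ((hX.1.const_mul (n : ℝ)).floor).prodMk ((hY.1.const_mul (n : ℝ)).floor)
    have hfin : (Set.range φ).Finite := by
      obtain ⟨M, hM⟩ := hX.2
      obtain ⟨N, hN⟩ := hY.2
      refine ((Set.finite_Icc (0 : ℤ) ⌊n * M⌋).prod (Set.finite_Icc (0 : ℤ) ⌊n * N⌋)).subset ?_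
      rintro _ ⟨ω, rfl⟩
      refine ⟨⟨Int.floor_nonneg.2 (mul_nonneg hn (hX0 ω)), Int.floor_le_floor ?_⟩,
        ⟨Int.floor_nonneg.2 (mul_nonneg hn (hY0 ω)), Int.floor_le_floor ?_⟩⟩
      · exact mul_le_mul_of_nonneg_left ((le_abs_self _).trans (hM ω)) hn
      · exact mul_le_mul_of_nonneg_left ((le_abs_self _).trans (hN ω)) hn
    have hx0 : ∀ ω, (0 : ℝ) ≤ ((φ ω).1 : ℝ) := fun ω =>
      Int.cast_nonneg (Int.floor_nonneg.2 (mul_nonneg hn (hX0 ω)))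
    have hy0 : ∀ ω, (0 : ℝ) ≤ ((φ ω).2 : ℝ) := fun ω =>
      Int.cast_nonneg (Int.floor_nonneg.2 (mul_nonneg hn (hY0 ω)))
    have hmeas : ∀ g : ℤ × ℤ → ℝ, Measurable g := fun g => measurable_of_countable g
    have hmem : ∀ g : ℤ × ℤ → ℝ, (fun ω => g (φ ω)) ∈ BddMeas Ω := fun g =>
      BddMeas.comp_mem hφ hfin (hmeas g)
    have hsum : J (fun ω => ((φ ω).1 : ℝ) + (φ ω).2) =
        J (fun ω => ((φ ω).1 : ℝ)) + J fun ω => ((φ ω).2 : ℝ) := by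
      rw [map_comp_eq_sum hadd hsmul hφ hfin (hmeas fun p => (p.1 : ℝ) + p.2)
          (fun ω => add_nonneg (hx0 ω) (hy0 ω)),
        map_comp_eq_sum hadd hsmul hφ hfin (hmeas fun p => (p.1 : ℝ)) hx0,
        map_comp_eq_sum hadd hsmul hφ hfin (hmeas fun p => (p.2 : ℝ)) hy0,
        ← Finset.sum_add_distrib]
      exact Finset.sum_congr rfl fun b _ => add_mul _ _ _
    have hsandwich : ∀ (g : ℤ × ℤ → ℝ) (Z : Ω → ℝ) (c : ℝ), Z ∈ BddMeas Ω → 0 ≤ c →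
        (∀ ω, g (φ ω) ≤ n * Z ω) → (∀ ω, n * Z ω ≤ g (φ ω) + c) →
        J (fun ω => g (φ ω)) ≤ n * J Z ∧ n * J Z ≤ J (fun ω => g (φ ω)) + c * m := by
      intro g Z c hZ hc hl hu
      have hcm := hsmul c hc _ (BddMeas.const_mem (Ω := Ω) 1)
      have hcmem := BddMeas.smul_mem c (BddMeas.const_mem (Ω := Ω) 1)
      have hshift := hadd _ (hmem g) _ hcmem (antimonotonic_const_right _ (c • (1 : ℝ)))
      rw [← hsmul n hn Z hZ, hm, ← hcm, ← hshift]
      refine ⟨hmono _ (hmem g) _ (BddMeas.smul_mem _ hZ) hl,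
        hmono _ (BddMeas.smul_mem _ hZ) _ (BddMeas.add_mem (hmem g) hcmem) fun ω => ?_⟩
      simpa using hu ω
    have hlX : ∀ ω, ((φ ω).1 : ℝ) ≤ n * X ω := fun ω => Int.floor_le _
    have hlY : ∀ ω, ((φ ω).2 : ℝ) ≤ n * Y ω := fun ω => Int.floor_le _
    have huX : ∀ ω, n * X ω ≤ ((φ ω).1 : ℝ) + 1 := fun ω => (Int.lt_floor_add_one _).le
    have huY : ∀ ω, n * Y ω ≤ ((φ ω).2 : ℝ) + 1 := fun ω => (Int.lt_floor_add_one _).le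
    obtain ⟨h1, h2⟩ := hsandwich (fun p => (p.1 : ℝ)) X 1 hX zero_le_one hlX huX
    obtain ⟨h3, h4⟩ := hsandwich (fun p => (p.2 : ℝ)) Y 1 hY zero_le_one hlY huY
    obtain ⟨h5, h6⟩ := hsandwich (fun p => (p.1 : ℝ) + p.2) (X + Y) 2 (BddMeas.add_mem hX hY)
      zero_le_two
      (fun ω => by rw [Pi.add_apply, mul_add]; exact add_le_add (hlX ω) (hlY ω))
      (fun ω => by rw [Pi.add_apply, mul_add]; linarith [huX ω, huY ω])
    nth_rw 1 [← abs_of_nonneg hn]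
    rw [← abs_mul, abs_le]
    constructor <;> linarith
  by_contra hne
  have hpos : 0 < |J (X + Y) - (J X + J Y)| := abs_pos.2 (sub_ne_zero.2 hne)
  obtain ⟨n, hn⟩ := exists_nat_gt (2 * m / |J (X + Y) - (J X + J Y)|)
  rw [div_lt_iff₀ hpos] at hn
  exact absurd (hbound n) (not_le.2 hn)

/-- A monotone, positively homogeneous functional on bounded measurable functions which is
additive on antimonotonic pairs is additive. -/
lemma map_add_of_antimonotonic_add
    (hmono : ∀ X ∈ BddMeas Ω, ∀ Y ∈ BddMeas Ω, (∀ ω, X ω ≤ Y ω) → J X ≤ J Y)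
    (hadd : ∀ X ∈ BddMeas Ω, ∀ Y ∈ BddMeas Ω, Antimonotonic X Y → J (X + Y) = J X + J Y)
    (hsmul : ∀ c : ℝ, 0 ≤ c → ∀ X ∈ BddMeas Ω, J (c • X) = c * J X)
    {X Y : Ω → ℝ} (hX : X ∈ BddMeas Ω) (hY : Y ∈ BddMeas Ω) : J (X + Y) = J X + J Y := by
  have hconst : ∀ Z ∈ BddMeas Ω, ∀ c : ℝ,
      J (Z + fun _ => c) = J Z + J fun _ => c := fun Z hZ c =>
    hadd _ hZ _ (BddMeas.const_mem c) (antimonotonic_const_right _ _)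
  obtain ⟨M, hM⟩ := hX.2
  obtain ⟨N, hN⟩ := hY.2
  have h := map_add_of_nonneg hmono hadd hsmul
    (BddMeas.add_mem hX (BddMeas.const_mem M)) (BddMeas.add_mem hY (BddMeas.const_mem N))
    (fun ω => by simpa using neg_le_iff_add_nonneg.1 (abs_le.1 (hM ω)).1)
    (fun ω => by simpa using neg_le_iff_add_nonneg.1 (abs_le.1 (hN ω)).1)
  rw [add_add_add_comm, hadd _ (BddMeas.add_mem hX hY) _
      (BddMeas.add_mem (BddMeas.const_mem M) (BddMeas.const_mem N))
      (antimonotonic_const_right _ (M + N)),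
    hconst _ (BddMeas.const_mem M), hconst _ hX, hconst _ hY] at h
  linarith

end Additivity

/-- A functional that is affine along segments towards an interior constant `k` extends to a
positively homogeneous functional centred at `k`. -/
lemma exists_homogeneous_extension {Ω : Type*} [MeasurableSpace Ω] {D : Set (Ω → ℝ)} {k ε : ℝ}
    (hε : 0 < ε) (hball : ∀ Y ∈ BddMeas Ω, (∀ ω, |Y ω - k| ≤ ε) → Y ∈ D) {I : (Ω → ℝ) → ℝ}
    (hI : ∀ α ∈ Set.Icc (0 : ℝ) 1, ∀ X ∈ D,
      I (fun ω => k + α * (X ω - k)) = α * I X + (1 - α) * I fun _ => k) :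
    ∃ J : (Ω → ℝ) → ℝ, ∀ X ∈ BddMeas Ω, ∀ t, 0 < t → (∀ ω, t * |X ω| ≤ ε) →
      (fun ω => k + t * X ω) ∈ D ∧ I (fun ω => k + t * X ω) = (I fun _ => k) + t * J X := by
  have hmem : ∀ X ∈ BddMeas Ω, ∀ t, 0 < t → (∀ ω, t * |X ω| ≤ ε) →
      (fun ω => k + t * X ω) ∈ D := fun X hX t ht h =>
    hball _ (BddMeas.add_mem (BddMeas.const_mem k) (BddMeas.smul_mem t hX)) fun ω => by
      simpa [abs_mul, abs_of_pos ht] using h ω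
  have hscale : ∀ X ∈ BddMeas Ω, ∀ s t, 0 < s → s ≤ t → (∀ ω, t * |X ω| ≤ ε) →
      (I (fun ω => k + s * X ω) - I fun _ => k) / s =
        (I (fun ω => k + t * X ω) - I fun _ => k) / t := by
    intro X hX s t hs hst h
    have ht := hs.trans_le hst
    have h1 := hI (s / t) ⟨by positivity, (div_le_one ht).2 hst⟩ _ (hmem X hX t ht h)
    have h2 : (fun ω => k + s / t * (k + t * X ω - k)) = fun ω => k + s * X ω := by
      funext ω
      field_simp
      ring
    rw [h2] at h1
    rw [h1]
    field_simp
    ring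
  have hex : ∀ X : Ω → ℝ, ∃ c : ℝ, X ∈ BddMeas Ω → ∀ t, 0 < t → (∀ ω, t * |X ω| ≤ ε) →
      (I (fun ω => k + t * X ω) - I fun _ => k) / t = c := by
    intro X
    by_cases hX : X ∈ BddMeas Ω
    · obtain ⟨s, hs, -, hsX, -⟩ := BddMeas.exists_pos_mul_abs_le hX hX hε
      refine ⟨(I (fun ω => k + s * X ω) - I fun _ => k) / s, fun _ t ht h => ?_⟩
      rcases le_total s t with hst | hst
      · exact (hscale X hX s t hs hst h).symm
      · exact hscale X hX t s ht hst hsX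
    · exact ⟨0, fun h => absurd h hX⟩
  choose J hJ using hex
  refine ⟨J, fun X hX t ht h => ⟨hmem X hX t ht h, ?_⟩⟩
  rw [← hJ X hX t ht h]
  field_simp
  ring

/-- On a convex subdomain of the bounded measurable functions containing a
sup-metric ball around a constant function, a monotone functional is
antimonotonically affine if and only if it is affine. -/
theorem am_affine_iff_affine_of_monotone {Ω : Type*} [MeasurableSpace Ω]
    (D : Set (Ω → ℝ)) (hDB : D ⊆ BddMeas Ω) (hconv : Convex ℝ D)
    (hball : ∃ k : ℝ, ∃ ε > (0:ℝ), ∀ Y ∈ BddMeas Ω,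
      (∀ ω, |Y ω - k| ≤ ε) → Y ∈ D)
    (I : (Ω → ℝ) → ℝ)
    (hmono : ∀ X ∈ D, ∀ Y ∈ D, (∀ ω, X ω ≥ Y ω) → I X ≥ I Y) :
    (∀ α ∈ Set.Icc (0:ℝ) 1, ∀ X ∈ D, ∀ Y ∈ D, Antimonotonic X Y →
      I (α • X + (1 - α) • Y) = α * I X + (1 - α) * I Y) ↔
    (∀ α ∈ Set.Icc (0:ℝ) 1, ∀ X ∈ D, ∀ Y ∈ D,
      I (α • X + (1 - α) • Y) = α * I X + (1 - α) * I Y) := by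
  refine ⟨fun h => ?_, fun h α hα X hX Y hY _ => h α hα X hX Y hY⟩
  obtain ⟨k, ε, hε, hball⟩ := hball
  have hkD : (fun _ => k : Ω → ℝ) ∈ D :=
    hball _ (BddMeas.const_mem k) fun ω => by simpa using hε.le
  have hk : ∀ α ∈ Set.Icc (0 : ℝ) 1, ∀ X ∈ D,
      I (fun ω => k + α * (X ω - k)) = α * I X + (1 - α) * I fun _ => k := by
    intro α hα X hX
    rw [← h α hα X hX _ hkD (antimonotonic_const_right X k)]
    congr 1
    funext ω
    simp only [Pi.add_apply, Pi.smul_apply, smul_eq_mul]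
    ring
  obtain ⟨J, hJ⟩ := exists_homogeneous_extension hε hball hk
  have hJmono : ∀ X ∈ BddMeas Ω, ∀ Y ∈ BddMeas Ω, (∀ ω, X ω ≤ Y ω) → J X ≤ J Y := by
    intro X hX Y hY hXY
    obtain ⟨t, ht, -, htX, htY⟩ := BddMeas.exists_pos_mul_abs_le hX hY hε
    obtain ⟨hXD, hXI⟩ := hJ X hX t ht htX
    obtain ⟨hYD, hYI⟩ := hJ Y hY t ht htY
    have := hmono _ hYD _ hXD fun ω => by
      have := mul_le_mul_of_nonneg_left (hXY ω) ht.le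
      simpa using this
    rw [hXI, hYI] at this
    exact le_of_mul_le_mul_left (by linarith) ht
  have hJadd : ∀ X ∈ BddMeas Ω, ∀ Y ∈ BddMeas Ω, Antimonotonic X Y →
      J (X + Y) = J X + J Y := by
    intro X hX Y hY hXY
    obtain ⟨t, ht, -, htX, htY⟩ := BddMeas.exists_pos_mul_abs_le hX hY hε
    obtain ⟨hXD, hXI⟩ := hJ X hX t ht htX
    obtain ⟨hYD, hYI⟩ := hJ Y hY t ht htY
    obtain ⟨-, hI⟩ := hJ (X + Y) (BddMeas.add_mem hX hY) (t / 2) (by positivity) fun ω => by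
      have := mul_le_mul_of_nonneg_left (abs_add_le (X ω) (Y ω)) ht.le
      rw [Pi.add_apply]
      linarith [htX ω, htY ω]
    have hmid := h (1 / 2) ⟨by norm_num, by norm_num⟩ _ hXD _ hYD (hXY.smul ht.le ht.le k)
    have heq : ((1 / 2 : ℝ) • (fun ω => k + t * X ω) + (1 - 1 / 2 : ℝ) • fun ω => k + t * Y ω) =
        fun ω => k + t / 2 * (X + Y) ω := by
      funext ω
      simp only [Pi.add_apply, Pi.smul_apply, smul_eq_mul]
      ring
    rw [heq, hI, hXI, hYI] at hmid
    exact mul_left_cancel₀ ht.ne' (by linarith)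
  have hJsmul : ∀ c : ℝ, 0 ≤ c → ∀ X ∈ BddMeas Ω, J (c • X) = c * J X := by
    intro c hc X hX
    obtain ⟨t, ht, -, htc, -⟩ :=
      BddMeas.exists_pos_mul_abs_le (BddMeas.smul_mem c hX) (BddMeas.smul_mem c hX) hε
    obtain ⟨-, hI⟩ := hJ _ (BddMeas.smul_mem c hX) t ht htc
    rcases hc.eq_or_lt with rfl | hc
    · simpa [ht.ne'] using hI
    · obtain ⟨-, hI'⟩ := hJ X hX (t * c) (by positivity) fun ω => by
        simpa [abs_mul, abs_of_pos hc, mul_assoc] using htc ω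
      simp only [Pi.smul_apply, smul_eq_mul, ← mul_assoc] at hI
      rw [hI'] at hI
      exact mul_left_cancel₀ ht.ne' (by linarith)
  have hIJ : ∀ Z ∈ D, I Z = (I fun _ => k) + J fun ω => Z ω - k := by
    intro Z hZ
    have hZB := BddMeas.sub_const_mem (hDB hZ) k
    obtain ⟨t, ht, ht1, htZ, -⟩ := BddMeas.exists_pos_mul_abs_le hZB hZB hε
    obtain ⟨-, hI⟩ := hJ _ hZB t ht htZ
    rw [hk t ⟨ht.le, ht1⟩ Z hZ] at hI
    exact mul_left_cancel₀ ht.ne' (by linarith)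
  intro α hα X hX Y hY
  have hα' : 0 ≤ 1 - α := sub_nonneg.2 hα.2
  have hXB := BddMeas.sub_const_mem (hDB hX) k
  have hYB := BddMeas.sub_const_mem (hDB hY) k
  have heq : (fun ω => (α • X + (1 - α) • Y) ω - k) =
      α • (fun ω => X ω - k) + (1 - α) • fun ω => Y ω - k := by
    funext ω
    simp only [Pi.add_apply, Pi.smul_apply, smul_eq_mul]
    ring
  rw [hIJ _ (hconv hX hY hα.1 hα' (by ring)), hIJ X hX, hIJ Y hY, heq,
    map_add_of_antimonotonic_add hJmono hJadd hJsmul (BddMeas.smul_mem _ hXB)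
      (BddMeas.smul_mem _ hYB), hJsmul _ hα.1 _ hXB, hJsmul _ hα' _ hYB]
  ring
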